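/- arXiv:2107.10578 — 4 statements merged into one kernel-verified Lean document; each statement's English description precedes it below -/
import Mathlib

section
/- (Generalised Cramér–Rao inequality.) Let θ ∈ ℝ, q ≥ 1, and α, β ∈ (1,∞) with 1/α + 1/β = 1. Let p : ℝ → ℝ be measurable with p(x) > 0, let Θ̂ : ℝ → ℝ be measurable, and let s : ℝ → ℝ be measurable (the score ∂θ ln p). Define Q_q = ∫ p(x)^q dx and assume Q_q < ∞, that x ↦ |Θ̂(x)−θ|^β·p(x) and x ↦ |s(x)|^α·p(x)^{α(q−1)+1} are integrable, and that ∫ (Θ̂(x)−θ)·s(x)·p(x)^q dx = Q_q/q. Then Q_q/q ≤ (∫ |Θ̂(x)−θ|^β·p(x) dx)^{1/β} · (∫ |s(x)|^α·p(x)^{α(q−1)+1} dx)^{1/α}. -/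
open MeasureTheory

/-- Generalised Cramér–Rao inequality: under the q-expectation unbiasedness condition
`∫ (Θ̂−θ)·s·p^q = Q_q/q` with `Q_q = ∫ p^q`, Hölder's inequality with conjugate exponents
`α, β` yields `Q_q/q ≤ (∫ |Θ̂−θ|^β p)^{1/β} · (∫ |s|^α p^{α(q−1)+1})^{1/α}`. -/
theorem generalised_cramer_rao
    (θ q α β : ℝ) (hq : 1 ≤ q) (hα : 1 < α) (hβ : 1 < β)
    (hconj : 1 / α + 1 / β = 1)
    (p Θhat s : ℝ → ℝ)
    (hmp : Measurable p) (hpos : ∀ x, 0 < p x)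
    (hmΘ : Measurable Θhat) (hms : Measurable s)
    (hQq : Integrable (fun x => p x ^ q))
    (hint1 : Integrable (fun x => |Θhat x - θ| ^ β * p x))
    (hint2 : Integrable (fun x => |s x| ^ α * p x ^ (α * (q - 1) + 1)))
    (hunbiased : ∫ x, (Θhat x - θ) * s x * p x ^ q = (∫ x, p x ^ q) / q) :
    (∫ x, p x ^ q) / q
      ≤ (∫ x, |Θhat x - θ| ^ β * p x) ^ (1 / β)
        * (∫ x, |s x| ^ α * p x ^ (α * (q - 1) + 1)) ^ (1 / α) := by
  have hα0 : 0 < α := by linarith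
  have hβ0 : 0 < β := by linarith
  have hβα : β.HolderConjugate α := by
    rw [Real.holderConjugate_iff]
    exact ⟨hβ, by simpa [add_comm] using hconj⟩
  set f : ℝ → ℝ := fun x => |Θhat x - θ| * p x ^ (1 / β) with hf
  set g : ℝ → ℝ := fun x => |s x| * p x ^ (q - 1 + 1 / α) with hg
  have hf0 : ∀ x, 0 ≤ f x := fun x =>
    mul_nonneg (abs_nonneg _) (Real.rpow_nonneg (hpos x).le _)
  have hg0 : ∀ x, 0 ≤ g x := fun x =>
    mul_nonneg (abs_nonneg _) (Real.rpow_nonneg (hpos x).le _)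
  have hfβ : ∀ x, f x ^ β = |Θhat x - θ| ^ β * p x := fun x => by
    rw [hf, Real.mul_rpow (abs_nonneg _) (Real.rpow_nonneg (hpos x).le _),
      ← Real.rpow_mul (hpos x).le, one_div_mul_cancel hβ0.ne', Real.rpow_one]
  have hgα : ∀ x, g x ^ α = |s x| ^ α * p x ^ (α * (q - 1) + 1) := fun x => by
    rw [hg, Real.mul_rpow (abs_nonneg _) (Real.rpow_nonneg (hpos x).le _),
      ← Real.rpow_mul (hpos x).le]
    congr 2
    field_simp
  have hfg : ∀ x, ‖(Θhat x - θ) * s x * p x ^ q‖ = f x * g x := fun x => by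
    have hexp : q = 1 / β + (q - 1 + 1 / α) := by linarith
    have hpq : p x ^ q = p x ^ (1 / β) * p x ^ (q - 1 + 1 / α) := by
      rw [← Real.rpow_add (hpos x), ← hexp]
    rw [Real.norm_eq_abs, abs_mul, abs_mul, abs_of_nonneg (Real.rpow_nonneg (hpos x).le q), hpq]
    ring
  have hfm : Measurable f := by fun_prop
  have hgm : Measurable g := by fun_prop
  have hfL : MemLp f (ENNReal.ofReal β) := by
    rw [← integrable_norm_rpow_iff hfm.aestronglyMeasurable (by simpa using hβ0)
      ENNReal.ofReal_ne_top, ENNReal.toReal_ofReal hβ0.le]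
    simpa only [Real.norm_of_nonneg (hf0 _), hfβ] using hint1
  have hgL : MemLp g (ENNReal.ofReal α) := by
    rw [← integrable_norm_rpow_iff hgm.aestronglyMeasurable (by simpa using hα0)
      ENNReal.ofReal_ne_top, ENNReal.toReal_ofReal hα0.le]
    simpa only [Real.norm_of_nonneg (hg0 _), hgα] using hint2
  calc (∫ x, p x ^ q) / q = ∫ x, (Θhat x - θ) * s x * p x ^ q := hunbiased.symm
    _ ≤ ∫ x, ‖(Θhat x - θ) * s x * p x ^ q‖ :=
      (Real.le_norm_self _).trans (norm_integral_le_integral_norm _)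
    _ = ∫ x, f x * g x := by simp only [hfg]
    _ ≤ (∫ x, f x ^ β) ^ (1 / β) * (∫ x, g x ^ α) ^ (1 / α) :=
      integral_mul_le_Lp_mul_Lq_of_nonneg hβα (ae_of_all _ hf0) (ae_of_all _ hg0) hfL hgL
    _ = _ := by simp only [hfβ, hgα]
end

section
/- Let n ≥ 1 be a natural number, let f, u : ℝ → ℝ and g, v : ℝ → ℝ be measurable with u ≥ 0 and v ≥ 0, and assume that for every k with 0 ≤ k ≤ 2n the functions x ↦ |f(x)|^{2n−k}·u(x) and y ↦ |g(y)|^k·v(y) are Lebesgue integrable. Then ∫∫ (f(x) + g(y))^{2n} · u(x)·v(y) dx dy = Σ_{k=0}^{2n} C(2n,k) · (∫ f(x)^{2n−k}·u(x) dx) · (∫ g(y)^k·v(y) dy), where C(2n,k) is the binomial coefficient. In particular, taking f, g to be the scores of two independent subsystems and u = p₁ⁿ, v = p₂ⁿ, the n-th order Fisher information of the product density p₁p₂ decomposes into the subsystem terms plus crossing terms, so it is not additive for n ≥ 2. -/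
open MeasureTheory

/-- A weighted power is integrable as soon as the absolute one is. -/
theorem integrable_pow_mul_of_integrable_abs_pow_mul {α : Type*} [MeasurableSpace α]
    {μ : Measure α} {f u : α → ℝ} (hf : Measurable f) (hu : Measurable u) (m : ℕ)
    (h : Integrable (fun x => |f x| ^ m * u x) μ) :
    Integrable (fun x => f x ^ m * u x) μ :=
  h.mono ((hf.pow_const m).mul hu).aestronglyMeasurable (ae_of_all _ fun x => by simp)

/-- Binomial decomposition of the n-th order Fisher information of a product density:
`∫∫ (f(x)+g(y))^{2n} u(x) v(y) dx dy
  = Σ_{k=0}^{2n} C(2n,k) (∫ f^{2n−k} u)(∫ g^k v)`,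
showing the n-th order Fisher information of two independent subsystems decomposes into
subsystem terms plus crossing terms (hence is not additive for `n ≥ 2`). -/
theorem nth_fisher_info_product_decomposition
    (n : ℕ) (hn : 1 ≤ n) (f u g v : ℝ → ℝ)
    (hf : Measurable f) (hu : Measurable u) (hg : Measurable g) (hv : Measurable v)
    (hu0 : ∀ x, 0 ≤ u x) (hv0 : ∀ y, 0 ≤ v y)
    (hint1 : ∀ k ≤ 2 * n, Integrable (fun x => |f x| ^ (2 * n - k) * u x))
    (hint2 : ∀ k ≤ 2 * n, Integrable (fun y => |g y| ^ k * v y)) :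
    ∫ x, ∫ y, (f x + g y) ^ (2 * n) * (u x * v y)
      = ∑ k ∈ Finset.range (2 * n + 1),
          (Nat.choose (2 * n) k : ℝ) * (∫ x, f x ^ (2 * n - k) * u x)
            * ∫ y, g y ^ k * v y := by
  have hF : ∀ k ∈ Finset.range (2 * n + 1), Integrable (fun x => f x ^ (2 * n - k) * u x) :=
    fun k hk => integrable_pow_mul_of_integrable_abs_pow_mul hf hu _
      (hint1 k (Finset.mem_range_succ_iff.mp hk))
  have hG : ∀ k ∈ Finset.range (2 * n + 1), Integrable (fun y => g y ^ k * v y) :=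
    fun k hk => integrable_pow_mul_of_integrable_abs_pow_mul hg hv _
      (hint2 k (Finset.mem_range_succ_iff.mp hk))
  have hexpand : ∀ x y, (f x + g y) ^ (2 * n) * (u x * v y)
      = ∑ k ∈ Finset.range (2 * n + 1),
          (Nat.choose (2 * n) k : ℝ) * (f x ^ (2 * n - k) * u x) * (g y ^ k * v y) := by
    intro x y
    rw [add_comm, add_pow, Finset.sum_mul]
    exact Finset.sum_congr rfl fun k _ => by ring
  have hinner : ∀ x, ∫ y, (f x + g y) ^ (2 * n) * (u x * v y)
      = ∑ k ∈ Finset.range (2 * n + 1),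
          (Nat.choose (2 * n) k : ℝ) * (f x ^ (2 * n - k) * u x) * ∫ y, g y ^ k * v y := by
    intro x
    simp_rw [hexpand]
    rw [integral_finsetSum _ fun k hk => (hG k hk).const_mul _]
    simp_rw [integral_const_mul]
  simp_rw [hinner]
  rw [integral_finsetSum _ fun k hk => ((hF k hk).const_mul _).mul_const _]
  simp_rw [integral_mul_const, integral_const_mul]
end

section
/- Let f, u : ℝ → ℝ and g, v : ℝ → ℝ be measurable with u ≥ 0 and v ≥ 0, and assume that for every k with 0 ≤ k ≤ 4 the functions x ↦ |f(x)|^{4−k}·u(x) and y ↦ |g(y)|^k·v(y) are Lebesgue integrable. Assume moreover the odd moments vanish: ∫ f(x)·u(x) dx = 0 and ∫ g(y)·v(y) dy = 0. Then ∫∫ (f(x)+g(y))⁴·u(x)·v(y) dx dy = (∫ v dy)·(∫ f⁴·u dx) + (∫ u dx)·(∫ g⁴·v dy) + 6·(∫ f²·u dx)·(∫ g²·v dy). Interpreted with f = ∂θ ln p₁, g = ∂θ ln p₂, u = p₁², v = p₂², this shows the second-order Fisher information of a product of two independent densities equals Q₂(p₂)-weighted and Q₂(p₁)-weighted subsystem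 terms plus a crossing term, hence is non-additive. -/
open MeasureTheory

/-- A signed moment is integrable as soon as the absolute moment is. -/
lemma integrable_pow_mul_of_abs {f u : ℝ → ℝ} (hf : Measurable f) (hu : Measurable u) {n : ℕ}
    (h : Integrable (fun x => |f x| ^ n * u x)) : Integrable (fun x => f x ^ n * u x) :=
  h.mono ((hf.pow_const n).mul hu).aestronglyMeasurable (.of_forall fun x => by simp)

/-- Binomial expansion of the moments of `f x + g y` against a product weight. -/
lemma integral_integral_add_pow_mul {f u g v : ℝ → ℝ} (n : ℕ)
    (hf : ∀ m ≤ n, Integrable (fun x => f x ^ m * u x))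
    (hg : ∀ m ≤ n, Integrable (fun y => g y ^ m * v y)) :
    ∫ x, ∫ y, (f x + g y) ^ n * (u x * v y)
      = ∑ m ∈ Finset.range (n + 1),
        n.choose m * (∫ x, f x ^ m * u x) * ∫ y, g y ^ (n - m) * v y := by
  have expand (x y : ℝ) : (f x + g y) ^ n * (u x * v y) = ∑ m ∈ Finset.range (n + 1),
      (n.choose m * (f x ^ m * u x)) * (g y ^ (n - m) * v y) := by
    rw [add_pow, Finset.sum_mul]
    exact Finset.sum_congr rfl fun m _ => by ring
  have inner (x : ℝ) : ∫ y, (f x + g y) ^ n * (u x * v y) = ∑ m ∈ Finset.range (n + 1),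
      (n.choose m * (f x ^ m * u x)) * ∫ y, g y ^ (n - m) * v y := by
    simp_rw [expand]
    rw [integral_finsetSum _ fun m _ => (hg (n - m) (n.sub_le m)).const_mul _]
    simp_rw [integral_const_mul]
  simp_rw [inner]
  rw [integral_finsetSum _ fun m hm =>
    ((hf m (Finset.mem_range_succ_iff.mp hm)).const_mul _).mul_const _]
  simp_rw [integral_mul_const, integral_const_mul]

/-- Non-additivity of the second-order Fisher information: for two independent subsystems
with vanishing odd moments,
`∫∫ (f+g)⁴ u v = (∫v)(∫f⁴u) + (∫u)(∫g⁴v) + 6(∫f²u)(∫g²v)`,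
i.e. subsystem terms weighted by the information generating functions plus a crossing term. -/
theorem second_fisher_info_product_decomposition
    (f u g v : ℝ → ℝ)
    (hf : Measurable f) (hu : Measurable u) (hg : Measurable g) (hv : Measurable v)
    (hu0 : ∀ x, 0 ≤ u x) (hv0 : ∀ y, 0 ≤ v y)
    (hint1 : ∀ k ≤ 4, Integrable (fun x => |f x| ^ (4 - k) * u x))
    (hint2 : ∀ k ≤ 4, Integrable (fun y => |g y| ^ k * v y))
    (hf0 : ∫ x, f x * u x = 0) (hg0 : ∫ y, g y * v y = 0) :
    ∫ x, ∫ y, (f x + g y) ^ 4 * (u x * v y)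
      = (∫ y, v y) * (∫ x, f x ^ 4 * u x) + (∫ x, u x) * (∫ y, g y ^ 4 * v y)
        + 6 * (∫ x, f x ^ 2 * u x) * ∫ y, g y ^ 2 * v y := by
  have moment_f (m : ℕ) (hm : m ≤ 4) : Integrable (fun x => f x ^ m * u x) := by
    have h := hint1 (4 - m) (Nat.sub_le 4 m)
    rw [Nat.sub_sub_self hm] at h
    exact integrable_pow_mul_of_abs hf hu h
  have moment_g (m : ℕ) (hm : m ≤ 4) : Integrable (fun y => g y ^ m * v y) :=
    integrable_pow_mul_of_abs hg hv (hint2 m hm)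
  rw [integral_integral_add_pow_mul 4 moment_f moment_g]
  simp [Finset.sum_range_succ, Nat.choose, hf0, hg0]
  ring
end

section
/- Let σ > 0 and μ ∈ ℝ, and let p : ℝ → ℝ be the normal density p(x) = (1/(√(2π)·σ))·exp(−(x−μ)²/(2σ²)). Then the (1,1) entry of the second-order Fisher information matrix satisfies ∫ p(x)²·[ ((x−μ)/σ²)⁴ + ((x−μ)/σ²)²·((x−μ)²/σ³ − 1/σ)² ] dx = 13·√π/(2⁴·π·σ⁵) = 13/(16·√π·σ⁵). -/
open MeasureTheory

theorem integrable_pow_mul_exp_neg_mul_sq {b : ℝ} (hb : 0 < b) (n : ℕ) :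
    Integrable fun x : ℝ => x ^ n * Real.exp (-b * x ^ 2) := by
  have hn : (-1 : ℝ) < n := by linarith [n.cast_nonneg (α := ℝ)]
  simpa only [Real.rpow_natCast] using integrable_rpow_mul_exp_neg_mul_sq hb hn

/-- Integration by parts for the moments of a centred Gaussian. -/
theorem integral_pow_add_two_mul_exp_neg_mul_sq {b : ℝ} (hb : 0 < b) (n : ℕ) :
    ∫ x : ℝ, x ^ (n + 2) * Real.exp (-b * x ^ 2)
      = (n + 1) / (2 * b) * ∫ x : ℝ, x ^ n * Real.exp (-b * x ^ 2) := by
  have hderiv : ∀ x : ℝ, HasDerivAt (fun x : ℝ => x ^ (n + 1) * Real.exp (-b * x ^ 2))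
      ((n + 1) * (x ^ n * Real.exp (-b * x ^ 2))
        - 2 * b * (x ^ (n + 2) * Real.exp (-b * x ^ 2))) x := fun x => by
    have h := (hasDerivAt_pow (n + 1) x).mul (((hasDerivAt_pow 2 x).const_mul (-b)).exp)
    refine h.congr_deriv ?_
    push_cast
    ring
  have hlow := (integrable_pow_mul_exp_neg_mul_sq hb n).const_mul ((n : ℝ) + 1)
  have hhigh := (integrable_pow_mul_exp_neg_mul_sq hb (n + 2)).const_mul (2 * b)
  have h := integral_eq_zero_of_hasDerivAt_of_integrable hderiv (hlow.sub hhigh)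
    (integrable_pow_mul_exp_neg_mul_sq hb (n + 1))
  rw [integral_sub hlow hhigh, integral_const_mul, integral_const_mul] at h
  rw [div_mul_eq_mul_div, eq_div_iff (by positivity)]
  linarith

theorem integral_sextic_mul_exp_neg_sq :
    ∫ x : ℝ, (x ^ 6 - x ^ 4 + x ^ 2) * Real.exp (-1 * x ^ 2) = 13 / 8 * √Real.pi := by
  have hint := integrable_pow_mul_exp_neg_mul_sq one_pos
  have h0 : ∫ x : ℝ, x ^ 0 * Real.exp (-1 * x ^ 2) = √Real.pi := by
    simpa using integral_gaussian 1
  have h2 := integral_pow_add_two_mul_exp_neg_mul_sq one_pos 0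
  have h4 := integral_pow_add_two_mul_exp_neg_mul_sq one_pos 2
  have h6 := integral_pow_add_two_mul_exp_neg_mul_sq one_pos 4
  norm_num only [Nat.reduceAdd] at h0 h2 h4 h6 hint ⊢
  simp only [add_mul, sub_mul]
  rw [integral_add (by exact (hint 6).sub (hint 4)) (hint 2), integral_sub (hint 6) (hint 4),
    h6, h4, h2, h0]
  ring

/-- The (1,1) entry of the second-order Fisher information matrix of the normal family:
`∫ p²[(∂_μ ln p)⁴ + (∂_μ ln p)²(∂_σ ln p)²] dx = 13√π/(2⁴π σ⁵) = 13/(16√π σ⁵)`. -/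
theorem second_fisher_matrix_normal_11
    (σ μ : ℝ) (hσ : 0 < σ) (p : ℝ → ℝ)
    (hp : p = fun x =>
      (1 / (Real.sqrt (2 * Real.pi) * σ)) * Real.exp (-(x - μ) ^ 2 / (2 * σ ^ 2))) :
    (∫ x, (p x) ^ 2 * (((x - μ) / σ ^ 2) ^ 4
        + ((x - μ) / σ ^ 2) ^ 2 * ((x - μ) ^ 2 / σ ^ 3 - 1 / σ) ^ 2))
      = 13 * Real.sqrt Real.pi / (2 ^ 4 * Real.pi * σ ^ 5) ∧
    13 * Real.sqrt Real.pi / (2 ^ 4 * Real.pi * σ ^ 5)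
      = 13 / (16 * Real.sqrt Real.pi * σ ^ 5) := by
  have hpi := Real.pi_pos
  constructor
  · let g : ℝ → ℝ := fun u => (u ^ 6 - u ^ 4 + u ^ 2) * Real.exp (-1 * u ^ 2)
    have hstandard : ∀ x, (p x) ^ 2 * (((x - μ) / σ ^ 2) ^ 4
        + ((x - μ) / σ ^ 2) ^ 2 * ((x - μ) ^ 2 / σ ^ 3 - 1 / σ) ^ 2)
        = 1 / (2 * Real.pi * σ ^ 6) * g ((x - μ) / σ) := fun x => by
      have hexp : Real.exp (-(x - μ) ^ 2 / (2 * σ ^ 2)) ^ 2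
          = Real.exp (-1 * ((x - μ) / σ) ^ 2) := by
        rw [← Real.exp_nat_mul]
        congr 1
        push_cast
        field_simp
      have hconst : (1 / (√(2 * Real.pi) * σ)) ^ 2 = 1 / (2 * Real.pi * σ ^ 2) := by
        rw [div_pow, mul_pow, Real.sq_sqrt (by positivity), one_pow]
      simp only [hp, g]
      rw [mul_pow, hexp, hconst]
      field_simp
      ring
    simp only [hstandard]
    rw [integral_const_mul, integral_sub_right_eq_self (fun x => g (x / σ)) μ,
      Measure.integral_comp_div, integral_sextic_mul_exp_neg_sq, abs_of_pos hσ, smul_eq_mul]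
    field_simp
    norm_num
  · field_simp
    rw [Real.sq_sqrt hpi.le]
    ring
end
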